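/- arXiv:1704.04072 — 2 statements merged into one kernel-verified Lean document; each statement's English description precedes it below -/
import Mathlib

section
/- The sequence 0 → I[R] → ℤ[Λ] → ℤ[X] → ℤ/2ℤ → 0 is exact, where the first map is the restriction of ν_{Λ/R} to I[R] ⊆ ℤ[R], the second map is σ, and the third map ε̄_X is the augmentation ε_X followed by reduction modulo 2. -/
open Finsupp LinearMap Function

/-- The set of 2-element subsets of a finite set `X`. -/
abbrev Pairs (X : Type) : Type := {s : Finset X // s.card = 2}

/-- The complement map `γ : Λ → Λ` sending a 2-element subset of a 4-element set to its
complement. -/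
def gammaMap (X : Type) [Fintype X] [DecidableEq X] (hX : Fintype.card X = 4) :
    Pairs X → Pairs X :=
  fun l => ⟨(l : Finset X)ᶜ, by rw [Finset.card_compl, l.2, hX]⟩

/-- The augmentation `ε_E : ℤ[E] → ℤ`. -/
noncomputable def epsAug (E : Type) : (E →₀ ℤ) →ₗ[ℤ] ℤ :=
  Finsupp.lsum ℤ fun _ => LinearMap.id

/-- The norm `ν_E : ℤ → ℤ[E]`, `1 ↦ Σ_{e ∈ E} e`. -/
noncomputable def nuNorm (E : Type) [Fintype E] : ℤ →ₗ[ℤ] (E →₀ ℤ) :=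
  ∑ e : E, Finsupp.lsingle e

/-- The relative augmentation `ε_{Λ/R} : ℤ[Λ] → ℤ[R]`, `λ ↦ π(λ)`. -/
noncomputable def epsRel {Λ R : Type} (π : Λ → R) : (Λ →₀ ℤ) →ₗ[ℤ] (R →₀ ℤ) :=
  Finsupp.lmapDomain ℤ ℤ π

/-- The relative norm `ν_{Λ/R} : ℤ[R] → ℤ[Λ]`, `r ↦ Σ_{π(λ) = r} λ`. -/
noncomputable def nuRel {Λ R : Type} [Fintype Λ] [DecidableEq R] (π : Λ → R) :
    (R →₀ ℤ) →ₗ[ℤ] (Λ →₀ ℤ) :=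
  Finsupp.lsum ℤ fun r => ∑ l ∈ Finset.univ.filter fun l => π l = r, Finsupp.lsingle l

/-- The map `σ : ℤ[Λ] → ℤ[X]`, `λ ↦ Σ_{x ∈ λ} x`. -/
noncomputable def sigmaMap (X : Type) [Fintype X] [DecidableEq X] :
    (Pairs X →₀ ℤ) →ₗ[ℤ] (X →₀ ℤ) :=
  Finsupp.lsum ℤ fun l => ∑ x ∈ (l : Finset X), Finsupp.lsingle x

/-- The map `τ : ℤ[X] → ℤ[Λ]`, `x ↦ Σ_{λ ∋ x} λ`. -/
noncomputable def tauMap (X : Type) [Fintype X] [DecidableEq X] :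
    (X →₀ ℤ) →ₗ[ℤ] (Pairs X →₀ ℤ) :=
  Finsupp.lsum ℤ fun x =>
    ∑ l ∈ Finset.univ.filter fun l : Pairs X => x ∈ (l : Finset X), Finsupp.lsingle l

theorem fin4_pairs : ∀ s : Finset (Fin 4), s.card = 2 →
    s = {0, 1} ∨ s = {0, 2} ∨ s = {0, 3} ∨ s = {1, 2} ∨ s = {1, 3} ∨ s = {2, 3} := by
  decide

theorem exists_four (X : Type) [Fintype X] [DecidableEq X] (hX : Fintype.card X = 4) :
    ∃ a b c d : X, a ≠ b ∧ a ≠ c ∧ a ≠ d ∧ b ≠ c ∧ b ≠ d ∧ c ≠ d ∧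
      (∀ x : X, x = a ∨ x = b ∨ x = c ∨ x = d) ∧
      ∀ s : Finset X, s.card = 2 →
        s = {a, b} ∨ s = {a, c} ∨ s = {a, d} ∨ s = {b, c} ∨ s = {b, d} ∨ s = {c, d} := by
  have e : Fin 4 ≃ X := (Fintype.equivFinOfCardEq hX).symm
  refine ⟨e 0, e 1, e 2, e 3, by simp, by simp, by simp, by simp, by simp, by simp, ?_, ?_⟩
  · intro x
    obtain ⟨i, rfl⟩ := e.surjective x
    fin_cases i <;> simp
  · intro s hs
    have hm : s = (s.image e.symm).image e := by simp [Finset.image_image]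
    have := fin4_pairs (s.image e.symm)
      (by rw [Finset.card_image_of_injective _ e.symm.injective, hs])
    rcases this with h | h | h | h | h | h <;> rw [h] at hm <;> simp [Finset.image_insert] at hm <;>
      simp [hm]

theorem nuRel_apply {Λ R : Type} [Fintype Λ] [DecidableEq R] (π : Λ → R) (f : R →₀ ℤ) (l : Λ) :
    nuRel π f l = f (π l) := by
  classical
  induction f using Finsupp.induction_linear with
  | zero => simp
  | add f g hf hg => simp [hf, hg]
  | single r n =>
    simp [nuRel, Finsupp.finsetSum_apply, Finsupp.single_apply, eq_comm]

theorem sigmaMap_apply (X : Type) [Fintype X] [DecidableEq X] (f : Pairs X →₀ ℤ) (x : X) :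
    sigmaMap X f x = ∑ l : Pairs X, if x ∈ l.1 then f l else 0 := by
  induction f using Finsupp.induction_linear with
  | zero => simp
  | add f g hf hg =>
    rw [map_add, Finsupp.add_apply, hf, hg, ← Finset.sum_add_distrib]
    refine Finset.sum_congr rfl fun l _ => ?_
    split_ifs <;> simp
  | single l n =>
    rw [Finset.sum_eq_single l]
    · simp [sigmaMap, Finsupp.finsetSum_apply, Finsupp.single_apply]
    · intro m _ hm
      simp [Finsupp.single_apply, hm.symm]
    · simp

theorem epsAug_eq (E : Type) (f : E →₀ ℤ) (s : Finset E) (hs : ∀ e, e ∈ s) :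
    epsAug E f = ∑ e ∈ s, f e := by
  simp only [epsAug, Finsupp.lsum_apply, LinearMap.id_apply]
  exact Finsupp.sum_of_support_subset _ (fun e _ => hs e) _ (by simp)

/-- The sequence `0 → I[R] → ℤ[Λ] → ℤ[X] → ℤ/2ℤ → 0` is exact, where the first map is the
restriction of `ν_{Λ/R}` to `I[R] = ker ε_R`, the second map is `σ`, and the third map is the
augmentation `ε_X` followed by reduction modulo 2. -/
theorem statement2 (X R : Type) [Fintype X] [DecidableEq X] [DecidableEq R]
    (hX : Fintype.card X = 4) (π : Pairs X → R)
    (hπsurj : Surjective π)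
    (hπ : ∀ l m : Pairs X, π l = π m ↔ m = l ∨ m = gammaMap X hX l) :
    Injective ((nuRel π) ∘ₗ (LinearMap.ker (epsAug R)).subtype) ∧
      LinearMap.range ((nuRel π) ∘ₗ (LinearMap.ker (epsAug R)).subtype) =
        LinearMap.ker (sigmaMap X) ∧
      LinearMap.range (sigmaMap X) =
        LinearMap.ker ((Algebra.linearMap ℤ (ZMod 2)) ∘ₗ epsAug X) ∧
      Surjective ((Algebra.linearMap ℤ (ZMod 2)) ∘ₗ epsAug X) := by
  obtain ⟨a, b, c, d, hab, hac, had, hbc, hbd, hcd, hx, hs⟩ := exists_four X hX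
  obtain ⟨ab, eab⟩ : ∃ l : Pairs X, l.1 = {a, b} := ⟨⟨{a, b}, Finset.card_pair hab⟩, rfl⟩
  obtain ⟨ac, eac⟩ : ∃ l : Pairs X, l.1 = {a, c} := ⟨⟨{a, c}, Finset.card_pair hac⟩, rfl⟩
  obtain ⟨ad, ead⟩ : ∃ l : Pairs X, l.1 = {a, d} := ⟨⟨{a, d}, Finset.card_pair had⟩, rfl⟩
  obtain ⟨bc, ebc⟩ : ∃ l : Pairs X, l.1 = {b, c} := ⟨⟨{b, c}, Finset.card_pair hbc⟩, rfl⟩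
  obtain ⟨bd, ebd⟩ : ∃ l : Pairs X, l.1 = {b, d} := ⟨⟨{b, d}, Finset.card_pair hbd⟩, rfl⟩
  obtain ⟨cd, ecd⟩ : ∃ l : Pairs X, l.1 = {c, d} := ⟨⟨{c, d}, Finset.card_pair hcd⟩, rfl⟩
  have hl : ∀ l : Pairs X, l = ab ∨ l = ac ∨ l = ad ∨ l = bc ∨ l = bd ∨ l = cd := by
    intro l
    simp only [Subtype.ext_iff, eab, eac, ead, ebc, ebd, ecd]
    exact hs l.1 l.2
  have ne : ∀ (l m : Pairs X) (x : X), x ∈ l.1 → x ∉ m.1 → l ≠ m := by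
    rintro l m x h1 h2 rfl
    exact h2 h1
  have n1 : ab ≠ ac := ne _ _ b (by simp [eab]) (by simp [eac, *, Ne.symm])
  have n2 : ab ≠ ad := ne _ _ b (by simp [eab]) (by simp [ead, hab.symm, hbd])
  have n3 : ab ≠ bc := ne _ _ a (by simp [eab]) (by simp [ebc, hab, hac])
  have n4 : ab ≠ bd := ne _ _ a (by simp [eab]) (by simp [ebd, hab, had])
  have n5 : ab ≠ cd := ne _ _ a (by simp [eab]) (by simp [ecd, hac, had])
  have n6 : ac ≠ ad := ne _ _ c (by simp [eac]) (by simp [ead, hac.symm, hcd])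
  have n7 : ac ≠ bc := ne _ _ a (by simp [eac]) (by simp [ebc, hab, hac])
  have n8 : ac ≠ bd := ne _ _ a (by simp [eac]) (by simp [ebd, hab, had])
  have n9 : ac ≠ cd := ne _ _ a (by simp [eac]) (by simp [ecd, hac, had])
  have n10 : ad ≠ bc := ne _ _ a (by simp [ead]) (by simp [ebc, hab, hac])
  have n11 : ad ≠ bd := ne _ _ a (by simp [ead]) (by simp [ebd, hab, had])
  have n12 : ad ≠ cd := ne _ _ a (by simp [ead]) (by simp [ecd, hac, had])
  have n13 : bc ≠ bd := ne _ _ c (by simp [ebc]) (by simp [ebd, hbc.symm, hcd])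
  have n14 : bc ≠ cd := ne _ _ b (by simp [ebc]) (by simp [ecd, hbc, hbd])
  have n15 : bd ≠ cd := ne _ _ b (by simp [ebd]) (by simp [ecd, hbc, hbd])
  have hsum : ∀ F : Pairs X → ℤ, ∑ l, F l = F ab + F ac + F ad + F bc + F bd + F cd := by
    intro F
    have hu : (Finset.univ : Finset (Pairs X)) = {ab, ac, ad, bc, bd, cd} := by
      ext l
      simpa using hl l
    rw [hu]
    simp only [Finset.sum_insert, Finset.mem_insert, Finset.mem_singleton, Finset.sum_singleton,
      n1, n2, n3, n4, n5, n6, n7, n8, n9, n10, n11, n12, n13, n14, n15, or_self,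
      not_false_eq_true]
    ring
  have sa : ∀ f : Pairs X →₀ ℤ, sigmaMap X f a = f ab + f ac + f ad := by
    intro f
    simp [sigmaMap_apply, hsum, eab, eac, ead, ebc, ebd, ecd, hab, hac, had]
  have sb : ∀ f : Pairs X →₀ ℤ, sigmaMap X f b = f ab + f bc + f bd := by
    intro f
    simp [sigmaMap_apply, hsum, eab, eac, ead, ebc, ebd, ecd, hab.symm, hbc, hbd]
  have sc : ∀ f : Pairs X →₀ ℤ, sigmaMap X f c = f ac + f bc + f cd := by
    intro f
    simp [sigmaMap_apply, hsum, eab, eac, ead, ebc, ebd, ecd, hac.symm, hbc.symm, hcd]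
  have sd : ∀ f : Pairs X →₀ ℤ, sigmaMap X f d = f ad + f bd + f cd := by
    intro f
    simp [sigmaMap_apply, hsum, eab, eac, ead, ebc, ebd, ecd, had.symm, hbd.symm, hcd.symm]
  have gab : gammaMap X hX ab = cd := by
    apply Subtype.ext
    ext x
    rcases hx x with rfl | rfl | rfl | rfl <;> simp [gammaMap, eab, ecd, *, Ne.symm]
  have gac : gammaMap X hX ac = bd := by
    apply Subtype.ext
    ext x
    rcases hx x with rfl | rfl | rfl | rfl <;> simp [gammaMap, eac, ebd, *, Ne.symm]
  have gad : gammaMap X hX ad = bc := by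
    apply Subtype.ext
    ext x
    rcases hx x with rfl | rfl | rfl | rfl <;> simp [gammaMap, ead, ebc, *, Ne.symm]
  have p1 : π cd = π ab := ((hπ ab cd).2 (Or.inr gab.symm)).symm
  have p2 : π bd = π ac := ((hπ ac bd).2 (Or.inr gac.symm)).symm
  have p3 : π bc = π ad := ((hπ ad bc).2 (Or.inr gad.symm)).symm
  have q1 : π ab ≠ π ac := by
    rw [Ne, hπ, gab]; simp [n1.symm, n9]
  have q2 : π ab ≠ π ad := by
    rw [Ne, hπ, gab]; simp [n2.symm, n12]
  have q3 : π ac ≠ π ad := by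
    rw [Ne, hπ, gac]; simp [n6.symm, n11]
  have er : ∀ f : R →₀ ℤ, epsAug R f = f (π ab) + f (π ac) + f (π ad) := by
    intro f
    rw [epsAug_eq R f {π ab, π ac, π ad}]
    · rw [Finset.sum_insert (by simp [q1, q2]), Finset.sum_insert (by simp [q3]),
        Finset.sum_singleton, add_assoc]
    · intro r
      obtain ⟨l, rfl⟩ := hπsurj r
      rcases hl l with rfl | rfl | rfl | rfl | rfl | rfl <;> simp [p1, p2, p3]
  have ex : ∀ f : X →₀ ℤ, epsAug X f = f a + f b + f c + f d := by
    intro f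
    rw [epsAug_eq X f {a, b, c, d}]
    · rw [Finset.sum_insert (by simp [hab, hac, had]), Finset.sum_insert (by simp [hbc, hbd]),
        Finset.sum_insert (by simp [hcd]), Finset.sum_singleton]
      ring
    · intro x
      simpa using hx x
  have extX : ∀ f g : X →₀ ℤ, f a = g a → f b = g b → f c = g c → f d = g d → f = g := by
    intro f g h1 h2 h3 h4
    ext x
    rcases hx x with rfl | rfl | rfl | rfl <;> assumption
  refine ⟨?_, ?_, ?_, ?_⟩
  · rintro ⟨f, hf⟩ ⟨g, hg⟩ h
    apply Subtype.ext
    ext r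
    obtain ⟨l, rfl⟩ := hπsurj r
    have := DFunLike.congr_fun h l
    simpa [nuRel_apply] using this
  · ext f
    constructor
    · rintro ⟨⟨g, hg⟩, rfl⟩
      rw [LinearMap.mem_ker, er] at hg
      rw [LinearMap.mem_ker]
      simp only [LinearMap.comp_apply, Submodule.subtype_apply]
      apply extX <;> simp only [sa, sb, sc, sd, nuRel_apply, p1, p2, p3, Finsupp.zero_apply] <;>
        linarith
    · intro hf
      rw [LinearMap.mem_ker] at hf
      have ha := sa f
      have hb := sb f
      have hc := sc f
      have hd := sd f
      rw [hf, Finsupp.zero_apply] at ha hb hc hd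
      let g : R →₀ ℤ := Finsupp.single (π ab) (f ab) + Finsupp.single (π ac) (f ac)
        + Finsupp.single (π ad) (f ad)
      have g1 : g (π ab) = f ab := by simp [g, Finsupp.single_apply, q1.symm, q2.symm]
      have g2 : g (π ac) = f ac := by simp [g, Finsupp.single_apply, q1, q3.symm]
      have g3 : g (π ad) = f ad := by simp [g, Finsupp.single_apply, q2, q3]
      refine ⟨⟨g, ?_⟩, ?_⟩
      · rw [LinearMap.mem_ker, er, g1, g2, g3, ← ha]
      · ext l
        simp only [LinearMap.comp_apply, Submodule.subtype_apply, nuRel_apply]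
        rcases hl l with rfl | rfl | rfl | rfl | rfl | rfl <;>
          simp only [p1, p2, p3, g1, g2, g3] <;> linarith
  · ext f
    have hk : f ∈ LinearMap.ker ((Algebra.linearMap ℤ (ZMod 2)) ∘ₗ epsAug X) ↔
        (2 : ℤ) ∣ f a + f b + f c + f d := by
      rw [LinearMap.mem_ker, LinearMap.comp_apply, ex, Algebra.linearMap_apply,
        eq_intCast (algebraMap ℤ (ZMod 2))]
      exact ZMod.intCast_zmod_eq_zero_iff_dvd _ 2
    rw [hk]
    constructor
    · rintro ⟨g, rfl⟩
      rw [sa, sb, sc, sd]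
      exact ⟨g ab + g ac + g ad + g bc + g bd + g cd, by ring⟩
    · rintro ⟨k, hk⟩
      let g : Pairs X →₀ ℤ := Finsupp.single ab (f a) + Finsupp.single bc (k - f a - f d)
        + Finsupp.single bd (k - f a - f c) + Finsupp.single cd (k - f b)
      have g1 : g ab = f a := by simp [g, Finsupp.single_apply, *, Ne.symm]
      have g2 : g ac = 0 := by
        simp [g, Finsupp.single_apply, n1, n7.symm, n8.symm, n9.symm]
      have g3 : g ad = 0 := by
        simp [g, Finsupp.single_apply, n2, n10.symm, n11.symm, n12.symm]
      have g4 : g bc = k - f a - f d := by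
        simp [g, Finsupp.single_apply, n3, n13.symm, n14.symm]
      have g5 : g bd = k - f a - f c := by
        simp [g, Finsupp.single_apply, n4, n13, n15.symm]
      have g6 : g cd = k - f b := by
        simp [g, Finsupp.single_apply, n5, n14, n15]
      refine ⟨g, ?_⟩
      apply extX <;> simp only [sa, sb, sc, sd, g1, g2, g3, g4, g5, g6] <;> linarith
  · intro z
    obtain ⟨n, rfl⟩ := ZMod.intCast_surjective z
    refine ⟨Finsupp.single a n, ?_⟩
    simp [epsAug]
end

section
/- The map τ sends the image of ν_X into the image of ν_Λ, hence induces a ℤ-linear map τ_J : J[X] → J[Λ]; the relative augmentation ε_{Λ/R} sends the image of ν_Λ into the image of ν_R, hence induces a map J[Λ] → J[R]; and the resulting sequence 0 → J[X] → J[Λ] → J[R] → 0 is a short exact sequence of ℤ-modules. -/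
open Finsupp LinearMap Function

theorem nuNorm_apply_aux (E : Type) [Fintype E] (c : ℤ) (e : E) : nuNorm E c e = c := by
  classical
  simp [nuNorm, LinearMap.sum_apply, Finsupp.finset_sum_apply, Finsupp.single_apply]

theorem mem_range_nuNorm_aux (E : Type) [Fintype E] (f : E →₀ ℤ) :
    f ∈ LinearMap.range (nuNorm E) ↔ ∃ c : ℤ, ∀ e, f e = c := by
  constructor
  · rintro ⟨c, rfl⟩
    exact ⟨c, nuNorm_apply_aux E c⟩
  · rintro ⟨c, hc⟩
    exact ⟨c, by ext e; rw [nuNorm_apply_aux, hc]⟩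

theorem tauMap_apply_aux (X : Type) [Fintype X] [DecidableEq X] (f : X →₀ ℤ) (l : Pairs X) :
    tauMap X f l = ∑ x ∈ (l : Finset X), f x := by
  induction f using Finsupp.induction_linear with
  | zero => simp
  | add f g hf hg => simp [hf, hg, Finset.sum_add_distrib]
  | single a b =>
    simp [tauMap, LinearMap.sum_apply, Finsupp.finset_sum_apply, Finsupp.single_apply,
      Finset.sum_ite_eq, Finset.sum_ite_eq']

theorem tauMap_pair_aux (X : Type) [Fintype X] [DecidableEq X] (f : X →₀ ℤ) (x y : X)
    (hxy : x ≠ y) (h : ({x, y} : Finset X).card = 2) :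
    tauMap X f ⟨{x, y}, h⟩ = f x + f y := by
  rw [tauMap_apply_aux]
  exact Finset.sum_pair hxy

theorem gammaMap_ne_aux (X : Type) [Fintype X] [DecidableEq X] (hX : Fintype.card X = 4)
    (l : Pairs X) : gammaMap X hX l ≠ l := by
  intro h
  have h' : ((l : Finset X))ᶜ = (l : Finset X) := congrArg Subtype.val h
  obtain ⟨x, hx⟩ : (l : Finset X).Nonempty := by
    rw [← Finset.card_pos, l.2]; norm_num
  have := hx
  rw [← h', Finset.mem_compl] at this
  exact this hx

theorem epsRel_apply_aux (X R : Type) [Fintype X] [DecidableEq X]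
    (hX : Fintype.card X = 4) (π : Pairs X → R)
    (hπ : ∀ l m : Pairs X, π l = π m ↔ m = l ∨ m = gammaMap X hX l)
    (g : Pairs X →₀ ℤ) (l : Pairs X) :
    epsRel π g (π l) = g l + g (gammaMap X hX l) := by
  classical
  induction g using Finsupp.induction_linear with
  | zero => simp
  | add f g hf hg => rw [map_add, Finsupp.add_apply, hf, hg]; simp only [Finsupp.add_apply]; ring
  | single a b =>
    have hne := gammaMap_ne_aux X hX l
    have h1 := hπ l a
    simp only [epsRel, Finsupp.lmapDomain_apply, Finsupp.mapDomain_single, Finsupp.single_apply]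
    by_cases h2 : a = l
    · subst h2
      simp [hne.symm]
    · by_cases h3 : a = gammaMap X hX l
      · have : π a = π l := (h1.2 (Or.inr h3)).symm
        simp [this, h2, ← h3]
      · have : π a ≠ π l := fun h => (h1.1 h.symm).elim h2 h3
        simp [this, h2, h3]

/-- The combinatorial core: exactness in the middle. -/
theorem middle_aux (X : Type) [Fintype X] [DecidableEq X] (hX : Fintype.card X = 4)
    (g : Pairs X →₀ ℤ) (c : ℤ) (hg : ∀ l, g l + g (gammaMap X hX l) = c) :
    ∃ (f : X →₀ ℤ) (d : ℤ), ∀ l, tauMap X f l = g l + d := by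
  obtain ⟨e⟩ : Nonempty (Fin 4 ≃ X) := ⟨(Fintype.equivFinOfCardEq hX).symm⟩
  have hc : ∀ i j : Fin 4, i ≠ j → ({e i, e j} : Finset X).card = 2 := fun i j h =>
    Finset.card_pair (e.injective.ne h)
  let G : Fin 4 → Fin 4 → ℤ := fun i j => if h : i ≠ j then g ⟨{e i, e j}, hc i j h⟩ else 0
  have hG : ∀ i j (h : i ≠ j), g ⟨{e i, e j}, hc i j h⟩ = G i j := fun i j h => by
    simp [G, h]
  have hsymm : ∀ i j, G i j = G j i := by
    intro i j
    by_cases h : i = j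
    · rw [h]
    · rw [← hG i j h, ← hG j i (Ne.symm h)]
      congr 2
      exact Finset.pair_comm _ _
  have hcomp : ∀ i j k l : Fin 4, i ≠ j → k ≠ l → ({i, j} : Finset (Fin 4))ᶜ = {k, l} →
      G i j + G k l = c := by
    intro i j k l h h' hs
    rw [← hG i j h, ← hG k l h', ← hg ⟨{e i, e j}, hc i j h⟩]
    congr 2
    apply Subtype.ext
    change ({e k, e l} : Finset X) = ({e i, e j} : Finset X)ᶜ
    ext x
    obtain ⟨m, rfl⟩ := e.surjective x
    have := Finset.ext_iff.1 hs m
    simp only [Finset.mem_compl, Finset.mem_insert, Finset.mem_singleton] at this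
    simp only [Finset.mem_compl, Finset.mem_insert, Finset.mem_singleton,
      e.injective.eq_iff]
    exact this.symm
  have e1 := hcomp 0 1 2 3 (by decide) (by decide) (by decide)
  have e2 := hcomp 0 2 1 3 (by decide) (by decide) (by decide)
  have e3 := hcomp 0 3 1 2 (by decide) (by decide) (by decide)
  let d : ℤ := G 0 1 + G 0 2 - G 1 2
  let F : Fin 4 → ℤ := fun i => if i = 0 then 0 else G 0 i - d
  have hF : ∀ i j : Fin 4, i ≠ j → F i + F j = G i j - d := by
    have s1 := hsymm 1 0
    have s2 := hsymm 2 0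
    have s3 := hsymm 3 0
    have s4 := hsymm 2 1
    have s5 := hsymm 3 1
    have s6 := hsymm 3 2
    intro i j h
    clear_value G
    fin_cases i <;> fin_cases j <;> first | exact absurd rfl h | (simp [F, d]; try lia)
  refine ⟨Finsupp.equivFunOnFinite.symm (fun x => F (e.symm x)), -d, ?_⟩
  rintro ⟨s, hs⟩
  obtain ⟨x, y, hxy, rfl⟩ := Finset.card_eq_two.1 hs
  obtain ⟨i, rfl⟩ := e.surjective x
  obtain ⟨j, rfl⟩ := e.surjective y
  have hij : i ≠ j := fun h => hxy (by rw [h])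
  rw [tauMap_pair_aux X _ _ _ hxy, hG i j hij]
  have := hF i j hij
  simp
  lia

/-- `τ` sends the image of `ν_X` into the image of `ν_Λ`, hence induces
`τ_J : J[X] → J[Λ]`; the relative augmentation `ε_{Λ/R}` sends the image of `ν_Λ` into the
image of `ν_R`, hence induces a map `J[Λ] → J[R]`; and the resulting sequence
`0 → J[X] → J[Λ] → J[R] → 0` is a short exact sequence of `ℤ`-modules. -/
theorem statement7 (X R : Type) [Fintype X] [DecidableEq X] [Fintype R] [DecidableEq R]
    (hX : Fintype.card X = 4) (π : Pairs X → R)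
    (hπsurj : Surjective π)
    (hπ : ∀ l m : Pairs X, π l = π m ↔ m = l ∨ m = gammaMap X hX l) :
    ∃ (h1 : LinearMap.range (nuNorm X) ≤
        (LinearMap.range (nuNorm (Pairs X))).comap (tauMap X))
      (h2 : LinearMap.range (nuNorm (Pairs X)) ≤
        (LinearMap.range (nuNorm R)).comap (epsRel π)),
      Injective (Submodule.mapQ (LinearMap.range (nuNorm X))
          (LinearMap.range (nuNorm (Pairs X))) (tauMap X) h1) ∧
        LinearMap.range (Submodule.mapQ (LinearMap.range (nuNorm X))
            (LinearMap.range (nuNorm (Pairs X))) (tauMap X) h1) =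
          LinearMap.ker (Submodule.mapQ (LinearMap.range (nuNorm (Pairs X)))
            (LinearMap.range (nuNorm R)) (epsRel π) h2) ∧
        Surjective (Submodule.mapQ (LinearMap.range (nuNorm (Pairs X)))
            (LinearMap.range (nuNorm R)) (epsRel π) h2) := by
  have h1 : LinearMap.range (nuNorm X) ≤
      (LinearMap.range (nuNorm (Pairs X))).comap (tauMap X) := by
    intro f hf
    obtain ⟨c, hc⟩ := (mem_range_nuNorm_aux X f).1 hf
    rw [Submodule.mem_comap, mem_range_nuNorm_aux]
    refine ⟨2 * c, fun l => ?_⟩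
    rw [tauMap_apply_aux, Finset.sum_congr rfl (fun x _ => hc x), Finset.sum_const, l.2]
    simp
  have hmem : ∀ g : Pairs X →₀ ℤ, epsRel π g ∈ LinearMap.range (nuNorm R) ↔
      ∃ c : ℤ, ∀ l, g l + g (gammaMap X hX l) = c := by
    intro g
    rw [mem_range_nuNorm_aux]
    simp only [hπsurj.forall, epsRel_apply_aux X R hX π hπ]
  have h2 : LinearMap.range (nuNorm (Pairs X)) ≤
      (LinearMap.range (nuNorm R)).comap (epsRel π) := by
    intro g hg
    obtain ⟨c, hc⟩ := (mem_range_nuNorm_aux _ g).1 hg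
    rw [Submodule.mem_comap, hmem]
    exact ⟨c + c, fun l => by rw [hc, hc]⟩
  refine ⟨h1, h2, ?_, ?_, ?_⟩
  · rw [injective_iff_map_eq_zero]
    intro q hq
    obtain ⟨f, rfl⟩ := Submodule.Quotient.mk_surjective _ q
    rw [Submodule.mapQ_apply, Submodule.Quotient.mk_eq_zero, mem_range_nuNorm_aux] at hq
    obtain ⟨c, hc⟩ := hq
    rw [Submodule.Quotient.mk_eq_zero, mem_range_nuNorm_aux]
    have hp : ∀ x y, x ≠ y → f x + f y = c := fun x y h => by
      rw [← tauMap_pair_aux X f x y h (Finset.card_pair h), hc]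
    have hall : ∀ x y, f x = f y := by
      intro x y
      by_cases h : x = y
      · rw [h]
      · obtain ⟨z, hz⟩ : ∃ z, z ∉ ({x, y} : Finset X) := by
          by_contra! hcon
          have := Finset.card_le_card (fun z _ => hcon z : (Finset.univ : Finset X) ⊆ {x, y})
          rw [Finset.card_univ, hX, Finset.card_pair h] at this
          omega
        simp only [Finset.mem_insert, Finset.mem_singleton, not_or] at hz
        have a1 := hp z x hz.1
        have a2 := hp z y hz.2
        lia
    have : Nonempty X := Fintype.card_pos_iff.1 (by omega)
    exact ⟨f (Classical.arbitrary X), fun x => hall _ _⟩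
  · ext q
    obtain ⟨g, rfl⟩ := Submodule.Quotient.mk_surjective _ q
    rw [LinearMap.mem_ker, Submodule.mapQ_apply, Submodule.Quotient.mk_eq_zero, hmem]
    constructor
    · rintro ⟨p, hp⟩
      obtain ⟨f, rfl⟩ := Submodule.Quotient.mk_surjective _ p
      rw [Submodule.mapQ_apply, Submodule.Quotient.eq, mem_range_nuNorm_aux] at hp
      obtain ⟨c, hc⟩ := hp
      refine ⟨∑ x, f x - 2 * c, fun l => ?_⟩
      have b1 := hc l
      have b2 := hc (gammaMap X hX l)
      rw [Finsupp.sub_apply, tauMap_apply_aux] at b1 b2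
      have b3 := Finset.sum_add_sum_compl (l : Finset X) f
      change ∑ x ∈ (l : Finset X)ᶜ, f x - _ = c at b2
      lia
    · rintro ⟨c, hc⟩
      obtain ⟨f, d, hf⟩ := middle_aux X hX g c hc
      refine ⟨Submodule.Quotient.mk f, ?_⟩
      rw [Submodule.mapQ_apply, Submodule.Quotient.eq, mem_range_nuNorm_aux]
      exact ⟨d, fun l => by rw [Finsupp.sub_apply, hf]; ring⟩
  · intro q
    obtain ⟨g, rfl⟩ := Submodule.Quotient.mk_surjective _ q
    obtain ⟨p, rfl⟩ := Finsupp.mapDomain_surjective (M := ℤ) hπsurj g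
    exact ⟨Submodule.Quotient.mk p, rfl⟩
end
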